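/- Let k ∈ ℝ, let I ⊆ ℝ be an interval, and let (θ, β): I → ℝ² be a C¹ solution of the system dθ/dt = k(kθ − 1) + βθ((θ + k)² − (1 + k²)), dβ/dt = β(1 − k²) − β²((θ + k)² + (1 − k²)). Then the pair (η, β) with η := βθ satisfies the system dη/dt = −2ηβ − kβ + η, dβ/dt = β(1 − k² − β) − 2kηβ − η² on I. -/

import Mathlib

/-- Let `(θ, β)` be a C¹ solution on an interval `I` of
`dθ/dt = k(kθ − 1) + βθ((θ + k)² − (1 + k²))`,
`dβ/dt = β(1 − k²) − β²((θ + k)² + (1 − k²))`.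
Then `(η, β)` with `η = βθ` satisfies
`dη/dt = −2ηβ − kβ + η`, `dβ/dt = β(1 − k² − β) − 2kηβ − η²` on `I`. -/
theorem eta_beta_system (k : ℝ) (I : Set ℝ) (hI : I.OrdConnected) (θ β : ℝ → ℝ)
    (hθ : ∀ t ∈ I, HasDerivAt θ
      (k * (k * θ t - 1) + β t * θ t * ((θ t + k) ^ 2 - (1 + k ^ 2))) t)
    (hβ : ∀ t ∈ I, HasDerivAt β
      (β t * (1 - k ^ 2) - (β t) ^ 2 * ((θ t + k) ^ 2 + (1 - k ^ 2))) t) :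
    ∀ t ∈ I,
      HasDerivAt (fun s => β s * θ s)
        (-2 * (β t * θ t) * β t - k * β t + β t * θ t) t ∧
      HasDerivAt β
        (β t * (1 - k ^ 2 - β t) - 2 * k * (β t * θ t) * β t - (β t * θ t) ^ 2) t := by
  intro t ht
  exact ⟨((hβ t ht).fun_mul (hθ t ht)).congr_deriv (by ring), (hβ t ht).congr_deriv (by ring)⟩
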